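/- Every abelian group G with no elements of order 4 embeds into an abelian group H with no elements of order 4 in which every element of odd order is divisible (i.e., for every h ∈ H of odd finite order and every positive integer n, there exists k ∈ H with nk = h). -/

import Mathlib

/-- The subgroup of elements of odd finite order. -/
def AddSubgroup.oddTorsion (E : Type*) [AddCommGroup E] : AddSubgroup E where
  carrier := {x | ∃ m : ℕ, Odd m ∧ m • x = 0}
  zero_mem' := ⟨1, odd_one, by simp⟩
  add_mem' := by
    rintro x y ⟨m, hm, hx⟩ ⟨n, hn, hy⟩
    exact ⟨m * n, hm.mul hn, by rw [smul_add, mul_comm, mul_smul, hx, mul_comm, mul_smul, hy]; simp⟩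
  neg_mem' := by
    rintro x ⟨m, hm, hx⟩
    exact ⟨m, hm, by rw [smul_neg, hx, neg_zero]⟩

theorem eq_zero_of_coprime_nsmul {A : Type*} [AddCommGroup A] {m n : ℕ} (hmn : m.Coprime n)
    {a : A} (hm : m • a = 0) (hn : n • a = 0) : a = 0 := by
  rw [← AddMonoid.addOrderOf_eq_one_iff]
  exact Nat.eq_one_of_dvd_coprimes hmn (addOrderOf_dvd_of_nsmul_eq_zero hm)
    (addOrderOf_dvd_of_nsmul_eq_zero hn)

theorem AddSubgroup.exists_mem_oddTorsion_nsmul_eq {E : Type*} [AddCommGroup E]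
    (hE : ∀ n : ℕ, 0 < n → ∀ x : E, ∃ y, n • y = x) {x : E} (hx : x ∈ oddTorsion E)
    {n : ℕ} (hn : 0 < n) : ∃ y ∈ oddTorsion E, n • y = x := by
  obtain ⟨m, hm, hmx⟩ := hx
  obtain ⟨k, r, hr, rfl⟩ := Nat.exists_eq_two_pow_mul_odd hn.ne'
  obtain ⟨y, rfl⟩ := hE r hr.pos x
  have hcop : (2 ^ k).Coprime (m * r) := (Nat.coprime_two_left.mpr (hm.mul hr)).pow_left k
  have hy : ((m * r : ℕ) : ℤ) • y = 0 := by rw [natCast_zsmul, mul_smul, hmx]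
  have hb := Nat.gcd_eq_gcd_ab (2 ^ k) (m * r)
  rw [hcop.gcd_eq_one] at hb
  set u := Nat.gcdA (2 ^ k) (m * r)
  set v := Nat.gcdB (2 ^ k) (m * r)
  refine ⟨u • y, ⟨m * r, hm.mul hr, ?_⟩, ?_⟩
  · rw [← natCast_zsmul, smul_comm, hy, smul_zero]
  · have hu : ((2 ^ k : ℕ) : ℤ) • u • y = y := by
      calc ((2 ^ k : ℕ) : ℤ) • u • y
          = (((2 ^ k : ℕ) : ℤ) * u) • y + v • ((m * r : ℕ) : ℤ) • y := by
            rw [hy, smul_zero, add_zero, mul_smul]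
        _ = (((2 ^ k : ℕ) : ℤ) * u + ((m * r : ℕ) : ℤ) * v) • y := by
            rw [add_smul, mul_comm _ v, mul_smul v]
        _ = y := by rw [← hb]; simp
    rw [mul_comm, mul_smul, ← natCast_zsmul _ (2 ^ k), hu]

theorem exists_injective_addMonoidHom_divisible.{u} (G : Type u) [AddCommGroup G] :
    ∃ (E : Type u) (_ : AddCommGroup E) (φ : G →+ E), Function.Injective φ ∧
      ∀ n : ℕ, 0 < n → ∀ x : E, ∃ y, n • y = x := by
  refine ⟨CharacterModule G → AddCircle (1 : ℚ), inferInstance,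
    AddMonoidHom.mk' (fun g c => c g) fun a b => funext fun c => map_add c a b, ?_, ?_⟩
  · rw [injective_iff_map_eq_zero]
    intro a ha
    by_contra hne
    obtain ⟨c, hc⟩ := CharacterModule.exists_character_apply_ne_zero_of_ne_zero hne
    exact hc (congrFun ha c)
  · intro n hn x
    refine ⟨fun c => DivisibleBy.div (x c) (n : ℤ), funext fun c => ?_⟩
    rw [Pi.smul_apply, ← natCast_zsmul]
    exact DivisibleBy.div_cancel (x c) (Int.natCast_ne_zero.mpr hn.ne')

/-- every abelian group with no elements of order 4 embeds into one with no
elements of order 4 in which every element of odd (finite) order is divisible. -/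
theorem stmt_4.{u} (G : Type u) [AddCommGroup G]
    (h4 : ∀ a : G, (4 : ℕ) • a = 0 → (2 : ℕ) • a = 0) :
    ∃ (H : Type u) (_ : AddCommGroup H) (φ : G →+ H),
      Function.Injective φ
      ∧ (∀ a : H, (4 : ℕ) • a = 0 → (2 : ℕ) • a = 0)
      ∧ (∀ h : H, addOrderOf h ≠ 0 → Odd (addOrderOf h) →
          ∀ n : ℕ, 0 < n → ∃ k : H, n • k = h) := by
  obtain ⟨E, _, φ, hφ, hE⟩ := exists_injective_addMonoidHom_divisible G
  let H : AddSubgroup E := φ.range ⊔ AddSubgroup.oddTorsion E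
  refine ⟨H, inferInstance,
    φ.codRestrict H fun g => AddSubgroup.mem_sup_left ⟨g, rfl⟩, ?_, ?_, ?_⟩
  · exact fun a b hab => hφ (congrArg Subtype.val hab)
  · rintro ⟨a, ha⟩ ha4
    obtain ⟨_, ⟨g, rfl⟩, d, ⟨m, hm, hd⟩, rfl⟩ := AddSubgroup.mem_sup.mp ha
    replace ha4 : 4 • (φ g + d) = 0 := congrArg Subtype.val ha4
    have hma : m • (φ g + d) = φ (m • g) := by rw [smul_add, hd, add_zero, map_nsmul]
    have hg : 2 • m • g = 0 := h4 _ <| hφ <| by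
      rw [map_nsmul, ← hma, smul_comm, ha4, smul_zero, map_zero]
    refine Subtype.ext (eq_zero_of_coprime_nsmul (Nat.coprime_two_left.mpr hm) ?_ ?_)
    · change 2 • 2 • (φ g + d) = 0
      rwa [← mul_smul]
    · change m • 2 • (φ g + d) = 0
      rw [smul_comm, hma, ← map_nsmul, hg, map_zero]
  · intro h _ hodd n hn
    have hmem : (h : E) ∈ AddSubgroup.oddTorsion E :=
      ⟨addOrderOf h, hodd, congrArg Subtype.val (addOrderOf_nsmul_eq_zero h)⟩
    obtain ⟨y, hy, hyh⟩ := AddSubgroup.exists_mem_oddTorsion_nsmul_eq hE hmem hn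
    exact ⟨⟨y, AddSubgroup.mem_sup_right hy⟩, Subtype.ext hyh⟩
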